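/- Let 𝒢 be a closed subgroup of Sym(P) with Aut(P) ⊆ 𝒢, let c₁, …, cₙ ∈ P, and let g : P → P be canonical from (P, c₁, …, cₙ) to P, M-generated by 𝒢, and such that g behaves like id on every orbit of (P, c₁, …, cₙ). Then either g behaves like id between every two distinct infinite orbits of (P, c₁, …, cₙ), or 𝒢 contains every rotation of P. -/

import Mathlib

variable {P : Type} [PartialOrder P]

/-- `a` and `b` are incomparable elements of the partial order `P`. -/
def Perp (a b : P) : Prop := ¬ a ≤ b ∧ ¬ b ≤ a

/-- `f` is an order-automorphism of `P`. -/
def IsOrderAuto (f : Equiv.Perm P) : Prop := ∀ a b : P, f a ≤ f b ↔ a ≤ b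

/-- `f` is an anti-automorphism of `P`. -/
def IsAntiAuto (f : Equiv.Perm P) : Prop := ∀ a b : P, f a ≤ f b ↔ b ≤ a

/-- Every finite partial order embeds into `P` (universality). -/
def IsUniversal (P : Type) [PartialOrder P] : Prop :=
  ∀ (Q : Type) [PartialOrder Q] [Fintype Q], Nonempty (Q ↪o P)

/-- Every order-isomorphism between two finite subsets of `P` extends to an
order-automorphism of `P` (homogeneity). -/
def IsHomogeneous (P : Type) [PartialOrder P] : Prop :=
  ∀ (S T : Finset P) (e : (S : Set P) ≃o (T : Set P)),
    ∃ g : P ≃o P, ∀ x : (S : Set P), g ↑x = ↑(e x)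

/-- A subgroup of `Sym(P)` is closed iff it contains every permutation that agrees
with one of its members on each finite subset of `P`. -/
def IsClosedSubgroup (G : Subgroup (Equiv.Perm P)) : Prop :=
  ∀ f : Equiv.Perm P,
    (∀ S : Finset P, ∃ g ∈ G, ∀ x ∈ S, (g : Equiv.Perm P) x = f x) → f ∈ G

/-- `h` is an order-automorphism of `P` fixing each of the constants `c i`. -/
def FixingAuto (n : ℕ) (c : Fin n → P) (h : Equiv.Perm P) : Prop :=
  IsOrderAuto h ∧ ∀ i : Fin n, h (c i) = c i

/-- `X` is an orbit of `(P, c₁, …, cₙ)`, i.e. an orbit of the action on `P` of the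
group of automorphisms of `P` fixing each `c i`. -/
def IsOrbit (n : ℕ) (c : Fin n → P) (X : Set P) : Prop :=
  ∃ x : P, X = {y | ∃ h : Equiv.Perm P, FixingAuto n c h ∧ h x = y}

/-- `g` is canonical as a function from `(P, c₁, …, cₙ)` to `P`. -/
def Canonical (n : ℕ) (c : Fin n → P) (g : P → P) : Prop :=
  ∀ (m : ℕ) (a b : Fin m → P),
    (∃ h : Equiv.Perm P, FixingAuto n c h ∧ ∀ j : Fin m, h (a j) = b j) →
    ∃ h' : Equiv.Perm P, IsOrderAuto h' ∧ ∀ j : Fin m, h' (g (a j)) = g (b j)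

/-- `g` is M-generated by the subgroup `G` of `Sym(P)`: on every finite subset of `P`
it agrees with some member of `G`. -/
def MGen (G : Subgroup (Equiv.Perm P)) (g : P → P) : Prop :=
  ∀ S : Finset P, ∃ h ∈ G, ∀ x ∈ S, (h : Equiv.Perm P) x = g x

/-- `g` behaves like `id` on `X`. -/
def BehavesLikeId (g : P → P) (X : Set P) : Prop :=
  ∀ x ∈ X, ∀ x' ∈ X, (x < x' → g x < g x') ∧ (Perp x x' → Perp (g x) (g x'))

/-- `g` behaves like `↕` on `X`. -/
def BehavesLikeRev (g : P → P) (X : Set P) : Prop :=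
  ∀ x ∈ X, ∀ x' ∈ X, (x < x' → g x' < g x) ∧ (Perp x x' → Perp (g x) (g x'))

/-- `g` behaves like `id` between `X` and `Y`. -/
def BehavesLikeIdBetween (g : P → P) (X Y : Set P) : Prop :=
  ∀ x ∈ X, ∀ y ∈ Y,
    (x < y → g x < g y) ∧ (y < x → g y < g x) ∧ (Perp x y → Perp (g x) (g y))

/-- `X ≤ Y` for subsets: some element of `X` lies below some element of `Y`. -/
def SetLE (X Y : Set P) : Prop := ∃ x ∈ X, ∃ y ∈ Y, x ≤ y

/-- `X < Y` for subsets: every element of `X` lies strictly below every element of `Y`. -/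
def SetLT (X Y : Set P) : Prop := ∀ x ∈ X, ∀ y ∈ Y, x < y

/-- The relation `X ÷ Y`. -/
def SetDiv (X Y : Set P) : Prop :=
  (SetLE X Y ∧ ¬ SetLE Y X ∧ ¬ SetLT X Y) ∨ (SetLE Y X ∧ ¬ SetLE X Y ∧ ¬ SetLT Y X)

/-- `f` is a rotation of `P`. -/
def IsRotation (f : Equiv.Perm P) : Prop :=
  ∃ X Y Z : Set P,
    (∀ p : P, p ∈ X ∨ p ∈ Y ∨ p ∈ Z) ∧
    Disjoint X Y ∧ Disjoint X Z ∧ Disjoint Y Z ∧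
    IsLowerSet X ∧ IsUpperSet Z ∧
    (∀ x ∈ X, ∀ z ∈ Z, x < z) ∧
    BehavesLikeId (⇑f) X ∧ BehavesLikeId (⇑f) Y ∧ BehavesLikeId (⇑f) Z ∧
    (∀ x ∈ X, ∀ z ∈ Z, f z < f x) ∧
    (∀ x ∈ X, ∀ y ∈ Y, (f y < f x ↔ Perp x y) ∧ (Perp (f x) (f y) ↔ x < y)) ∧
    (∀ y ∈ Y, ∀ z ∈ Z, (f z < f y ↔ Perp y z) ∧ (Perp (f y) (f z) ↔ y < z))

/-- The ternary relation `Cyc`. -/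
def Cyc (a b c : P) : Prop :=
  (a < b ∧ b < c) ∨ (b < c ∧ c < a) ∨ (c < a ∧ a < b) ∨
  (a < b ∧ Perp c a ∧ Perp c b) ∨ (b < c ∧ Perp a b ∧ Perp a c) ∨
  (c < a ∧ Perp b a ∧ Perp b c)

/-- The ternary relation `Cyc'`, the dual of `Cyc`. -/
def Cyc' (a b c : P) : Prop := Cyc c b a

/-- The ternary relation `Pari`. -/
def Pari (a b c : P) : Prop :=
  (Perp a b ∧ Perp b c ∧ Perp a c) ∨
  (a < b ∧ a < c ∧ Perp b c) ∨ (b < a ∧ b < c ∧ Perp a c) ∨ (c < a ∧ c < b ∧ Perp a b) ∨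
  (b < a ∧ c < a ∧ Perp b c) ∨ (a < b ∧ c < b ∧ Perp a c) ∨ (a < c ∧ b < c ∧ Perp a b)

/-- `f` preserves the ternary relation `R`. -/
def Preserves3 (f : P → P) (R : P → P → P → Prop) : Prop :=
  ∀ a b c : P, R a b c ↔ R (f a) (f b) (f c)

/-- Some member of `G` maps the tuple `a` to the tuple `b`. -/
def TupleRel {Ω A : Type} (G : Subgroup (Equiv.Perm Ω)) (a b : A → Ω) : Prop :=
  ∃ h ∈ G, ∀ i, (h : Equiv.Perm Ω) (a i) = b i

theorem TupleRel.symm {Ω A : Type} {G : Subgroup (Equiv.Perm Ω)} {a b : A → Ω}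
    (h : TupleRel G a b) : TupleRel G b a := by
  obtain ⟨h, hh, H⟩ := h
  exact ⟨h⁻¹, G.inv_mem hh, fun i => by rw [← H i]; simp⟩

theorem TupleRel.trans {Ω A : Type} {G : Subgroup (Equiv.Perm Ω)} {a b d : A → Ω}
    (h : TupleRel G a b) (h' : TupleRel G b d) : TupleRel G a d := by
  obtain ⟨h, hh, H⟩ := h
  obtain ⟨k, hk, K⟩ := h'
  exact ⟨k * h, G.mul_mem hk hh, fun i => by simp [H, K]⟩

theorem TupleRel.injective {Ω A : Type} {G : Subgroup (Equiv.Perm Ω)} {a b : A → Ω}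
    (h : TupleRel G a b) (ha : Function.Injective a) : Function.Injective b := by
  obtain ⟨h, -, H⟩ := h
  intro i j hij
  rw [← H i, ← H j] at hij
  exact ha (h.injective hij)

/-- Homogeneity for tuples indexed by a finite type. -/
theorem IsHomogeneous.exists_auto (hH : IsHomogeneous P) {A : Type} [Finite A] (a b : A → P)
    (hab : ∀ i j, a i ≤ a j ↔ b i ≤ b j) :
    ∃ h : Equiv.Perm P, IsOrderAuto h ∧ ∀ i, h (a i) = b i := by
  classical
  have := Fintype.ofFinite A
  have eab : ∀ i j, a i = a j ↔ b i = b j := by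
    intro i j
    rw [le_antisymm_iff, le_antisymm_iff, hab, hab]
  let S : Finset P := Finset.univ.image a
  let T : Finset P := Finset.univ.image b
  have hS : ∀ x : (S : Set P), ∃ i, a i = x := by
    intro x; have := x.2; simpa [S] using this
  have hT : ∀ x : (T : Set P), ∃ i, b i = x := by
    intro x; have := x.2; simpa [T] using this
  choose u hu using hS
  choose v hv using hT
  let e : (S : Set P) ≃o (T : Set P) :=
    { toFun := fun x => ⟨b (u x), by simp [T]⟩
      invFun := fun y => ⟨a (v y), by simp [S]⟩
      left_inv := by
        intro x
        apply Subtype.ext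
        change a (v _) = x
        rw [← hu x, eab, hv]
      right_inv := by
        intro x
        apply Subtype.ext
        change b (u _) = x
        rw [← hv x, ← eab, hu]
      map_rel_iff' := by
        intro x y
        change b (u x) ≤ b (u y) ↔ (x : P) ≤ y
        rw [← hab, hu, hu] }
  obtain ⟨g, hg⟩ := hH S T e
  refine ⟨g.toEquiv, fun x y => g.le_iff_le, fun i => ?_⟩
  have hi : a i ∈ (S : Set P) := by simp [S]
  have h1 := hg ⟨a i, hi⟩
  change g (a i) = b i
  rw [h1]
  change b (u _) = b i
  rw [← eab, hu]

theorem TupleRel.of_le_iff (hH : IsHomogeneous P) {G : Subgroup (Equiv.Perm P)}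
    (hAut : ∀ f : Equiv.Perm P, IsOrderAuto f → f ∈ G) {A : Type} [Finite A] {a b : A → P}
    (hab : ∀ i j, a i ≤ a j ↔ b i ≤ b j) : TupleRel G a b := by
  obtain ⟨h, h1, h2⟩ := hH.exists_auto a b hab
  exact ⟨h, hAut h h1, h2⟩

/-- A finite tuple of `P` extends to a copy of any finite partial order extending its type. -/
theorem exists_extension (hU : IsUniversal P) (hH : IsHomogeneous P) {A Q : Type} [Finite A]
    [Finite Q] [PartialOrder Q] (ι : A → Q) (a : A → P) (h : ∀ i j, ι i ≤ ι j ↔ a i ≤ a j) :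
    ∃ e : Q ↪o P, ∀ i, e (ι i) = a i := by
  have := Fintype.ofFinite Q
  obtain ⟨e⟩ := hU Q
  obtain ⟨k, hk, hk'⟩ := hH.exists_auto (fun i => e (ι i)) a (fun i j => by simp [h])
  refine ⟨⟨⟨fun q => k (e q), fun x y hxy => e.injective (k.injective hxy)⟩, ?_⟩, hk'⟩
  intro x y
  change k (e x) ≤ k (e y) ↔ _
  rw [hk, e.le_iff_le]

/-- The one-point extension property of the random partial order. -/
theorem exists_point (hU : IsUniversal P) (hH : IsHomogeneous P) {S : Set P} (hS : S.Finite)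
    (D U : P → Prop)
    (hD : ∀ s ∈ S, ∀ t ∈ S, s ≤ t → D t → D s) (hUp : ∀ s ∈ S, ∀ t ∈ S, s ≤ t → U s → U t)
    (hDU : ∀ s ∈ S, ∀ t ∈ S, D s → U t → s < t) :
    ∃ z, ∀ s ∈ S, (s ≤ z ↔ D s) ∧ (z ≤ s ↔ U s) := by
  have := hS.to_subtype
  let r : Option S → Option S → Prop
    | none, none => True
    | none, some s => U s
    | some s, none => D s
    | some s, some t => (s : P) ≤ t
  let po : PartialOrder (Option S) :=
    { le := r
      lt := fun x y => r x y ∧ ¬ r y x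
      lt_iff_le_not_ge := fun _ _ => Iff.rfl
      le_refl := by rintro (_ | s) <;> simp [r]
      le_trans := by
        rintro (_ | ⟨s, hs⟩) (_ | ⟨t, ht⟩) (_ | ⟨u, hu⟩) <;> simp only [r] <;> grind
      le_antisymm := by
        rintro (_ | ⟨s, hs⟩) (_ | ⟨t, ht⟩) <;> simp only [r] <;> grind }
  obtain ⟨e, he⟩ := exists_extension hU hH (fun s : S => some s) (fun s : S => (s : P))
    (fun i j => Iff.rfl)
  refine ⟨e none, fun s hs => ?_⟩
  have h1 := he ⟨s, hs⟩
  simp only at h1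
  constructor
  · nth_rewrite 1 [← h1]
    rw [e.le_iff_le]
    exact Iff.rfl
  · nth_rewrite 1 [← h1]
    rw [e.le_iff_le]
    exact Iff.rfl

/-- `x` and `y` have the same type over the constants. -/
def SameType {n : ℕ} (c : Fin n → P) (x y : P) : Prop :=
  ∀ k, (c k ≤ x ↔ c k ≤ y) ∧ (x ≤ c k ↔ y ≤ c k)

/-- Every tuple can be copied so that its entries get prescribed types over the constants,
as long as these types are compatible with the order of the tuple. -/
theorem exists_copy_sameType (hU : IsUniversal P) (hH : IsHomogeneous P) {n : ℕ} (c : Fin n → P)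
    {A : Type} [Finite A] (a t : A → P) (ha : Function.Injective a)
    (h1 : ∀ i j, a i ≤ a j → ∀ k, (t j ≤ c k → t i ≤ c k) ∧ (c k ≤ t i → c k ≤ t j))
    (h2 : ∀ i j k, t i ≤ c k → ¬ c k ≤ t j) :
    ∃ e : A → P, (∀ i j, e i ≤ e j ↔ a i ≤ a j) ∧ ∀ i, SameType c (e i) (t i) := by
  let C := Set.range c
  have hc : ∀ k : C, ∃ i, c i = k := fun k => k.2
  have h1' : ∀ i j, a i ≤ a j → ∀ k : C, (t j ≤ k → t i ≤ k) ∧ (k ≤ t i → k ≤ t j) := by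
    intro i j hij k
    obtain ⟨l, hl⟩ := hc k
    rw [← hl]
    exact h1 i j hij l
  have h2' : ∀ i j, ∀ k l : C, t i ≤ k → (k : P) ≤ l → ¬ l ≤ t j := by
    intro i j k l hk hkl hl
    obtain ⟨l', hl'⟩ := hc l
    rw [← hl'] at hkl hl
    exact h2 i j l' (hk.trans hkl) hl
  let r : A ⊕ C → A ⊕ C → Prop
    | .inl i, .inl j => a i ≤ a j
    | .inl i, .inr k => t i ≤ k
    | .inr k, .inl i => k ≤ t i
    | .inr k, .inr l => (k : P) ≤ l
  let po : PartialOrder (A ⊕ C) :=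
    { le := r
      lt := fun x y => r x y ∧ ¬ r y x
      lt_iff_le_not_ge := fun _ _ => Iff.rfl
      le_refl := by rintro (i | k) <;> simp [r]
      le_trans := by
        rintro (i | i) (j | j) (k | k) <;> simp only [r] <;> intro hij hjk
        · exact hij.trans hjk
        · exact (h1' _ _ hij _).1 hjk
        · exact absurd hjk (h2' _ _ _ _ hij le_rfl)
        · exact hij.trans hjk
        · exact (h1' _ _ hjk _).2 hij
        · exact hij.trans hjk
        · exact hij.trans hjk
        · exact hij.trans hjk
      le_antisymm := by
        rintro (i | i) (j | j) <;> simp only [r] <;> intro hij hji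
        · exact congrArg _ (ha (le_antisymm hij hji))
        · exact absurd hji (h2' _ _ _ _ hij le_rfl)
        · exact absurd hij (h2' _ _ _ _ hji le_rfl)
        · exact congrArg _ (Subtype.ext (le_antisymm hij hji)) }
  obtain ⟨e, he⟩ := exists_extension hU hH (fun k : C => (Sum.inr k : A ⊕ C))
    (fun k : C => (k : P)) (fun i j => Iff.rfl)
  refine ⟨fun i => e (Sum.inl i), fun i j => by rw [e.le_iff_le]; exact Iff.rfl, fun i k => ?_⟩
  have hk := he ⟨c k, k, rfl⟩
  simp only at hk
  constructor
  · nth_rewrite 1 [← hk]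
    rw [e.le_iff_le]
    exact Iff.rfl
  · nth_rewrite 1 [← hk]
    rw [e.le_iff_le]
    exact Iff.rfl

/-- Every finite tuple, split into a lower part and an upper part `F`, is mapped by some member
of `G` to a tuple with unchanged order inside the two parts, where the order between them
depends only on the original relation, as described by `α β γ δ`. -/
def CrossStep (G : Subgroup (Equiv.Perm P)) (α β γ δ : Prop) : Prop :=
  ∀ (A : Type) [Finite A] (a : A → P) (F : Set A), Function.Injective a →
    (∀ i j, i ∈ F → a i ≤ a j → j ∈ F) →
    ∃ m : A → P, TupleRel G a m ∧
      (∀ i j, (i ∈ F ↔ j ∈ F) → (m i ≤ m j ↔ a i ≤ a j)) ∧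
      (∀ i j, i ∉ F → j ∈ F → a i ≤ a j → (m i ≤ m j ↔ α) ∧ (m j ≤ m i ↔ β)) ∧
      (∀ i j, i ∉ F → j ∈ F → ¬ a i ≤ a j → (m i ≤ m j ↔ γ) ∧ (m j ≤ m i ↔ δ))

theorem CrossStep.constraints (hU : IsUniversal P) (hH : IsHomogeneous P)
    {G : Subgroup (Equiv.Perm P)} {α β γ δ : Prop} (h : CrossStep G α β γ δ) :
    ¬ (α ∧ δ) ∧ ¬ (β ∧ γ) ∧ (γ → α) ∧ (β → δ) := by
  obtain ⟨p, -⟩ := exists_point hU hH Set.finite_empty (fun _ => False) (fun _ => False)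
    (by simp) (by simp) (by simp)
  obtain ⟨q, hq⟩ := exists_point hU hH (Set.finite_singleton p) (fun _ => False) (fun _ => False)
    (by simp) (by simp) (by simp)
  obtain ⟨r, hr⟩ := exists_point hU hH (S := {p, q}) (Set.toFinite _) (fun s => s = p)
    (fun _ => False) (by grind) (by simp) (by simp)
  obtain ⟨q', hq'⟩ := exists_point hU hH (Set.finite_singleton p) (fun _ => True) (fun _ => False)
    (by simp) (by simp) (by simp)
  obtain ⟨r', hr'⟩ := exists_point hU hH (S := {p, q'}) (Set.toFinite _) (fun s => s = p)
    (fun _ => False) (by grind) (by simp) (by simp)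
  have key : ∀ x y z : P, ¬ y ≤ x → x ≤ z → ¬ z ≤ x → ¬ y ≤ z → ¬ z ≤ y →
      ∃ x' y' z' : P, (x' ≤ y' ↔ x ≤ y) ∧ ¬ y' ≤ x' ∧ (x' ≤ z' ↔ α) ∧ (z' ≤ x' ↔ β) ∧
        (y' ≤ z' ↔ γ) ∧ (z' ≤ y' ↔ δ) := by
    intro x y z h1 h2 h3 h4 h5
    obtain ⟨m, -, hm1, hm2, hm3⟩ := h (Fin 3) ![x, y, z] {2}
      (by
        intro i j
        fin_cases i <;> fin_cases j <;> simp <;> grind)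
      (by
        intro i j
        fin_cases i <;> fin_cases j <;> simp <;> grind)
    have a1 := hm1 0 1 (by simp)
    have a2 := hm1 1 0 (by simp)
    have a3 := hm2 0 2 (by simp) (by simp) (by simpa using h2)
    have a4 := hm3 1 2 (by simp) (by simp) (by simpa using h4)
    simp only [Matrix.cons_val_zero, Matrix.cons_val_one] at a1 a2
    exact ⟨m 0, m 1, m 2, a1, by rw [a2]; exact h1, a3.1, a3.2, a4.1, a4.2⟩
  have k1 := key p q r
  have k2 := key p q' r'
  simp only [Set.mem_singleton_iff, Set.mem_insert_iff, forall_eq_or_imp, forall_eq] at *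
  obtain ⟨x, y, z, b⟩ := k1 (by grind) (by grind) (by grind) (by grind) (by grind)
  obtain ⟨x', y', z', b'⟩ := k2 (by grind) (by grind) (by grind) (by grind) (by grind)
  have t1 : x ≤ z → z ≤ y → x ≤ y := le_trans
  have t2 : y ≤ z → z ≤ x → y ≤ x := le_trans
  have t3 : x' ≤ y' → y' ≤ z' → x' ≤ z' := le_trans
  have t4 : z' ≤ x' → x' ≤ y' → z' ≤ y' := le_trans
  grind

/-- If the result of a crossing step does not depend on the original relation, every tuple
is mapped to an antichain by a member of `G`. -/
theorem CrossStep.exists_antichain (hU : IsUniversal P) (hH : IsHomogeneous P)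
    {G : Subgroup (Equiv.Perm P)} (hAut : ∀ f : Equiv.Perm P, IsOrderAuto f → f ∈ G)
    {α β : Prop} (h : CrossStep G α β α β) {A : Type} [Finite A] (a : A → P)
    (ha : Function.Injective a) :
    ∃ m : A → P, TupleRel G a m ∧ ∀ i j, m i ≤ m j → i = j := by
  classical
  let K : (A → P) → Set A := fun m => {i | ∃ j, j ≠ i ∧ (m i ≤ m j ∨ m j ≤ m i)}
  induction hk : (K a).ncard using Nat.strong_induction_on generalizing a with
  | _ k ih =>
  by_cases hne : (K a).Nonempty
  · obtain ⟨j, hjK, hj⟩ := Set.Finite.exists_maximalFor a (K a) (Set.toFinite _) hne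
    obtain ⟨z, hz⟩ := exists_point hU hH (Set.finite_range a) (fun _ => False) (fun _ => False)
      (by simp) (by simp) (by simp)
    have hz1 : ∀ i, ¬ a i ≤ z := fun i => by simpa using (hz (a i) ⟨i, rfl⟩).1
    have hz2 : ∀ i, ¬ z ≤ a i := fun i => by simpa using (hz (a i) ⟨i, rfl⟩).2
    have hmax : ∀ i, a j ≤ a i → i = j := by
      intro i hi
      by_contra hij
      exact hij (ha (le_antisymm (hj ⟨j, fun h => hij h.symm, Or.inr hi⟩ hi) hi))
    let b := Function.update a j z
    have hbj : b j = z := by simp [b]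
    have hbi : ∀ i, i ≠ j → b i = a i := fun i hi => by simp [b, hi]
    have hb : Function.Injective b := by
      intro i i' hii
      by_cases h1 : i = j <;> by_cases h2 : i' = j
      · rw [h1, h2]
      · subst h1
        rw [hbj, hbi _ h2] at hii
        exact absurd hii.le (hz2 _)
      · subst h2
        rw [hbj, hbi _ h1] at hii
        exact absurd hii.le (hz1 _)
      · rw [hbi _ h1, hbi _ h2] at hii
        exact ha hii
    obtain ⟨m, hm, m1, m2, m3⟩ := h A a {j} ha (by
      rintro i i' rfl hii
      exact hmax _ hii)
    obtain ⟨m', hm', m1', m2', m3'⟩ := h A b {j} hb (by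
      rintro i i' rfl hii
      by_contra hne'
      rw [hbj, hbi _ hne'] at hii
      exact hz2 _ hii)
    have hmm : TupleRel G m m' := by
      apply TupleRel.of_le_iff hH hAut
      intro i i'
      simp only [Set.mem_singleton_iff] at *
      by_cases h1 : i = j <;> by_cases h2 : i' = j
      · subst h1 h2; simp
      · grind
      · grind
      · rw [m1 _ _ (by simp [h1, h2]), m1' _ _ (by simp [h1, h2]), hbi _ h1, hbi _ h2]
    have hab : TupleRel G a b := (hm.trans hmm).trans hm'.symm
    have hlt : (K b).ncard < (K a).ncard := by
      apply Set.ncard_lt_ncard _ (Set.toFinite _)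
      refine (Set.ssubset_iff_of_subset ?_).2 ⟨j, hjK, ?_⟩
      · rintro i ⟨i', hi', hii⟩
        by_cases h1 : i = j
        · rwa [h1]
        · refine ⟨i', hi', ?_⟩
          by_cases h2 : i' = j
          · subst h2
            rw [hbj, hbi _ h1] at hii
            exact absurd hii (by simp [hz1, hz2])
          · rwa [hbi _ h1, hbi _ h2] at hii
      · rintro ⟨i', hi', hii⟩
        rw [hbj, hbi _ hi'] at hii
        exact absurd hii (by simp [hz1, hz2])
    obtain ⟨m, hm, hm'⟩ := ih _ (hk ▸ hlt) b hb rfl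
    exact ⟨m, hab.trans hm, hm'⟩
  · refine ⟨a, ⟨1, G.one_mem, fun _ => rfl⟩, fun i j hij => ?_⟩
    by_contra hij'
    exact hne ⟨i, j, fun h => hij' h.symm, Or.inl hij⟩

theorem CrossStep.mem_of_const (hU : IsUniversal P) (hH : IsHomogeneous P)
    {G : Subgroup (Equiv.Perm P)} (hG : IsClosedSubgroup G)
    (hAut : ∀ f : Equiv.Perm P, IsOrderAuto f → f ∈ G)
    {α β : Prop} (h : CrossStep G α β α β) (f : Equiv.Perm P) : f ∈ G := by
  apply hG
  intro S
  obtain ⟨m, hm, hm'⟩ := h.exists_antichain hU hH hAut (fun s : S => (s : P))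
    Subtype.val_injective
  obtain ⟨k, hk, hk'⟩ := h.exists_antichain hU hH hAut (fun s : S => f (s : P))
    (f.injective.comp Subtype.val_injective)
  have hmk : TupleRel G m k := TupleRel.of_le_iff hH hAut fun i j =>
    ⟨fun hij => (hm' i j hij) ▸ le_rfl, fun hij => (hk' i j hij) ▸ le_rfl⟩
  obtain ⟨u, hu, hu'⟩ := (hm.trans hmk).trans hk.symm
  exact ⟨u, hu, fun x hx => hu' ⟨x, hx⟩⟩

theorem BehavesLikeId.le_iff {g : P → P} {X : Set P} (h : BehavesLikeId g X)
    {x y : P} (hx : x ∈ X) (hy : y ∈ X) : g x ≤ g y ↔ x ≤ y := by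
  constructor
  · intro hxy
    by_contra hn
    by_cases hyx : y ≤ x
    · exact absurd hxy ((h y hy x hx).1 (lt_of_le_not_ge hyx hn)).not_ge
    · exact ((h x hx y hy).2 ⟨hn, hyx⟩).1 hxy
  · intro hxy
    rcases hxy.lt_or_eq with hlt | rfl
    · exact ((h x hx y hy).1 hlt).le
    · exact le_rfl

theorem CrossStep.rotation_mem (hH : IsHomogeneous P)
    {G : Subgroup (Equiv.Perm P)} (hG : IsClosedSubgroup G)
    (hAut : ∀ f : Equiv.Perm P, IsOrderAuto f → f ∈ G)
    (h : CrossStep G False False False True) (f : Equiv.Perm P) (hf : IsRotation f) : f ∈ G := by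
  obtain ⟨X, Y, Z, hcov, hXY, hXZ, hYZ, hX, hZ, hlt, iX, iY, iZ, fXZ, fXY, fYZ⟩ := hf
  have hXY' : ∀ x ∈ X, x ∉ Y := fun _ hx => Set.disjoint_left.1 hXY hx
  have hXZ' : ∀ x ∈ X, x ∉ Z := fun _ hx => Set.disjoint_left.1 hXZ hx
  have hYZ' : ∀ x ∈ Y, x ∉ Z := fun _ hx => Set.disjoint_left.1 hYZ hx
  have eXY : ∀ x ∈ X, ∀ y ∈ Y, ¬ y ≤ x ∧ ¬ f x ≤ f y ∧ (f y ≤ f x ↔ ¬ x ≤ y) := by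
    intro x hx y hy
    have h0 : ¬ y ≤ x := fun hyx => hXY' y (hX hyx hx) hy
    obtain ⟨h1, h2⟩ := fXY x hx y hy
    by_cases hxy : x ≤ y
    · have := h2.2 (lt_of_le_not_ge hxy h0)
      exact ⟨h0, this.1, by simp [this.2, hxy]⟩
    · have := h1.2 ⟨hxy, h0⟩
      exact ⟨h0, this.not_ge, by simp [this.le, hxy]⟩
  have eYZ : ∀ y ∈ Y, ∀ z ∈ Z, ¬ z ≤ y ∧ ¬ f y ≤ f z ∧ (f z ≤ f y ↔ ¬ y ≤ z) := by
    intro x hx y hy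
    have h0 : ¬ y ≤ x := fun hyx => hYZ' x hx (hZ hyx hy)
    obtain ⟨h1, h2⟩ := fYZ x hx y hy
    by_cases hxy : x ≤ y
    · have := h2.2 (lt_of_le_not_ge hxy h0)
      exact ⟨h0, this.1, by simp [this.2, hxy]⟩
    · have := h1.2 ⟨hxy, h0⟩
      exact ⟨h0, this.not_ge, by simp [this.le, hxy]⟩
  have eXZ : ∀ x ∈ X, ∀ z ∈ Z, x ≤ z ∧ ¬ z ≤ x ∧ ¬ f x ≤ f z ∧ f z ≤ f x := by
    intro x hx z hz
    exact ⟨(hlt x hx z hz).le, (hlt x hx z hz).not_ge, (fXZ x hx z hz).not_ge, (fXZ x hx z hz).le⟩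
  apply hG
  intro S
  let a : S → P := Subtype.val
  have ha : Function.Injective a := Subtype.val_injective
  obtain ⟨m, hm, m1, m2, m3⟩ := h S a {i | a i ∈ Z} ha (fun i j hi hij => hZ hij hi)
  simp only [Set.mem_ofPred_eq, iff_false, iff_true] at m1 m2 m3
  have hup : ∀ i j, a i ∉ X → m i ≤ m j → a j ∉ X := by
    intro i j hi hij hj
    by_cases hiZ : a i ∈ Z
    · exact (m2 j i (hXZ' _ hj) hiZ (eXZ _ hj _ hiZ).1).2 hij
    · rw [m1 i j (by simp [hiZ, hXZ' _ hj])] at hij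
      exact hi (hX hij hj)
  obtain ⟨m', hm', m1', m2', m3'⟩ := h S m {i | a i ∉ X} (hm.injective ha) hup
  simp only [Set.mem_ofPred_eq, iff_false, iff_true, not_not] at m1' m2' m3'
  have hfin : TupleRel G m' (fun i => f (a i)) := by
    apply TupleRel.of_le_iff hH hAut
    intro i j
    have lX := @BehavesLikeId.le_iff P _ f X iX (a i) (a j)
    have lY := @BehavesLikeId.le_iff P _ f Y iY (a i) (a j)
    have lZ := @BehavesLikeId.le_iff P _ f Z iZ (a i) (a j)
    have ci := hcov (a i)
    have cj := hcov (a j)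
    clear h hm hm' hup hAut hG hH hcov hlt fXZ fXY fYZ hX hZ iX iY iZ ha
    clear_value a
    grind
  obtain ⟨u, hu, hu'⟩ := (hm.trans hm').trans hfin
  exact ⟨u, hu, fun x hx => hu' ⟨x, hx⟩⟩

theorem SameType.exists_fixing (hH : IsHomogeneous P) {n : ℕ} {c : Fin n → P} {x x' y y' : P}
    (hx : SameType c x x') (hy : SameType c y y') (h1 : x ≤ y ↔ x' ≤ y') (h2 : y ≤ x ↔ y' ≤ x') :
    ∃ h : Equiv.Perm P, FixingAuto n c h ∧ h x = x' ∧ h y = y' := by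
  obtain ⟨h, hh, h'⟩ := hH.exists_auto (A := Fin n ⊕ Bool)
    (Sum.elim c (fun b => cond b x y)) (Sum.elim c (fun b => cond b x' y')) (by
      rintro (i | (_ | _)) (j | (_ | _)) <;>
      simp only [Sum.elim_inl, Sum.elim_inr, cond_true, cond_false, le_refl] <;>
      first
        | exact h1
        | exact h2
        | exact (hx _).1
        | exact (hx _).2
        | exact (hy _).1
        | exact (hy _).2)
  exact ⟨h, ⟨hh, fun i => h' (Sum.inl i)⟩, h' (Sum.inr true), h' (Sum.inr false)⟩

theorem Canonical.le_iff (hH : IsHomogeneous P) {n : ℕ} {c : Fin n → P} {g : P → P}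
    (hcan : Canonical n c g) {x x' y y' : P}
    (hx : SameType c x x') (hy : SameType c y y') (h1 : x ≤ y ↔ x' ≤ y') (h2 : y ≤ x ↔ y' ≤ x') :
    (g x ≤ g y ↔ g x' ≤ g y') ∧ (g y ≤ g x ↔ g y' ≤ g x') := by
  obtain ⟨h, hh, e1, e2⟩ := hx.exists_fixing hH hy h1 h2
  obtain ⟨k, hk, hk'⟩ := hcan 2 ![x, y] ![x', y'] ⟨h, hh, by
    intro j
    fin_cases j <;> simp [e1, e2]⟩
  have k0 : k (g x) = g x' := hk' 0
  have k1 : k (g y) = g y' := hk' 1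
  rw [← k0, ← k1, hk, hk]
  exact ⟨Iff.rfl, Iff.rfl⟩

theorem SameType.le_iff_of_id (hH : IsHomogeneous P) {n : ℕ} {c : Fin n → P} {g : P → P}
    (hid : ∀ X : Set P, IsOrbit n c X → BehavesLikeId g X) {x y : P} (h : SameType c x y) :
    g x ≤ g y ↔ x ≤ y := by
  obtain ⟨k, hk, hk', -⟩ := h.exists_fixing hH h (by simp) (by simp)
  exact (hid _ ⟨x, rfl⟩).le_iff ⟨1, ⟨fun _ _ => Iff.rfl, fun _ => rfl⟩, rfl⟩ ⟨k, hk, hk'⟩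

/-- If the type of `x` admits elements both below and incomparable to elements of the type
of `y`, then `g` respects the relation between `x` and `y`, unless `G` contains all rotations. -/
theorem le_iff_of_not_rotation (hU : IsUniversal P) (hH : IsHomogeneous P)
    {G : Subgroup (Equiv.Perm P)} (hG : IsClosedSubgroup G)
    (hAut : ∀ f : Equiv.Perm P, IsOrderAuto f → f ∈ G)
    {n : ℕ} {c : Fin n → P} {g : P → P}
    (hcan : Canonical n c g) (hM : MGen G g)
    (hid : ∀ X : Set P, IsOrbit n c X → BehavesLikeId g X)
    (hrot : ¬ ∀ f : Equiv.Perm P, IsRotation f → f ∈ G) {x y : P}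
    (hx : ∀ k, x ≠ c k) (hy : ∀ k, y ≠ c k)
    (hxy : ∀ k, (c k ≤ x → c k ≤ y) ∧ (y ≤ c k → x ≤ c k) ∧ ¬ (x ≤ c k ∧ c k ≤ y))
    (hyx : ¬ y ≤ x) :
    (g x ≤ g y ↔ x ≤ y) ∧ ¬ g y ≤ g x := by
  classical
  have hcopy : ∀ {A : Type} [Finite A] (a : A → P) (F : Set A), Function.Injective a →
      (∀ i j, i ∈ F → a i ≤ a j → j ∈ F) →
      ∃ e : A → P, (∀ i j, e i ≤ e j ↔ a i ≤ a j) ∧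
        (∀ i ∈ F, SameType c (e i) y) ∧ (∀ i ∉ F, SameType c (e i) x) := by
    intro A _ a F ha hF
    obtain ⟨e, he, he'⟩ := exists_copy_sameType hU hH c a (fun i => if i ∈ F then y else x) ha
      (by
        intro i j hij k
        have := hF i j
        have := hxy k
        by_cases hi : i ∈ F <;> by_cases hj : j ∈ F <;> grind)
      (by
        intro i j k
        have := hxy k
        have := hx k
        have := hy k
        by_cases hi : i ∈ F <;> by_cases hj : j ∈ F <;> grind)
    exact ⟨e, he, fun i hi => by simpa [hi] using he' i, fun i hi => by simpa [hi] using he' i⟩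
  obtain ⟨q, hq⟩ := exists_point hU hH (Set.finite_singleton x) (fun _ => False) (fun _ => False)
    (by simp) (by simp) (by simp)
  obtain ⟨r, hr⟩ := exists_point hU hH (Set.finite_singleton x) (fun _ => True) (fun _ => False)
    (by simp) (by simp) (by simp)
  simp only [Set.mem_singleton_iff, forall_eq, iff_false, iff_true] at hq hr
  have hpair : ∀ u, ¬ u ≤ x → ∃ x' y', SameType c x' x ∧ SameType c y' y ∧
      (x' ≤ y' ↔ x ≤ u) ∧ ¬ y' ≤ x' := by
    intro u hu
    obtain ⟨e, he, h1, h2⟩ := hcopy (fun b : Bool => cond b x u) {false}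
      (by rintro (_ | _) (_ | _) <;> simp <;> grind)
      (by rintro (_ | _) (_ | _) <;> simp <;> grind)
    exact ⟨e true, e false, h2 true (by simp), h1 false (by simp), he true false,
      by rw [he false true]; exact hu⟩
  obtain ⟨x₁, y₁, hx₁, hy₁, l₁, l₁'⟩ := hpair r hr.2
  obtain ⟨x₂, y₂, hx₂, hy₂, l₂, l₂'⟩ := hpair q hq.2
  have hstep : CrossStep G (g x₁ ≤ g y₁) (g y₁ ≤ g x₁) (g x₂ ≤ g y₂) (g y₂ ≤ g x₂) := by
    intro A _ a F ha hF
    obtain ⟨e, he, h1, h2⟩ := hcopy a F ha hF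
    have := Fintype.ofFinite A
    have hrel : TupleRel G e (fun i => g (e i)) := by
      obtain ⟨h, hh, hh'⟩ := hM (Finset.univ.image e)
      exact ⟨h, hh, fun i => hh' _ (by simp)⟩
    refine ⟨fun i => g (e i),
      (TupleRel.of_le_iff hH hAut fun i j => (he i j).symm).trans hrel, ?_, ?_, ?_⟩
    · intro i j hij
      rw [← he]
      apply SameType.le_iff_of_id hH hid
      by_cases hi : i ∈ F
      · exact fun k => ⟨(h1 i hi k).1.trans (h1 j (hij.1 hi) k).1.symm,
          (h1 i hi k).2.trans (h1 j (hij.1 hi) k).2.symm⟩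
      · have hj : j ∉ F := fun h => hi (hij.2 h)
        exact fun k => ⟨(h2 i hi k).1.trans (h2 j hj k).1.symm,
          (h2 i hi k).2.trans (h2 j hj k).2.symm⟩
    all_goals
      intro i j hi hj hij
      apply hcan.le_iff hH
      · exact fun k => ⟨(h2 i hi k).1.trans (by first | exact (hx₁ k).1.symm | exact (hx₂ k).1.symm),
          (h2 i hi k).2.trans (by first | exact (hx₁ k).2.symm | exact (hx₂ k).2.symm)⟩
      · exact fun k => ⟨(h1 j hj k).1.trans (by first | exact (hy₁ k).1.symm | exact (hy₂ k).1.symm),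
          (h1 j hj k).2.trans (by first | exact (hy₁ k).2.symm | exact (hy₂ k).2.symm)⟩
      · grind
      · have := hF j i hj
        grind
  have hinj : Function.Injective g := by
    intro u v huv
    obtain ⟨h, -, hh⟩ := hM {u, v}
    apply h.injective
    rw [hh u (by simp), hh v (by simp), huv]
  have n1 : ¬ (g x₁ ≤ g y₁ ∧ g y₁ ≤ g x₁) := fun h =>
    l₁' (hinj (le_antisymm h.1 h.2)).ge
  have n2 : ¬ (g x₂ ≤ g y₂ ∧ g y₂ ≤ g x₂) := fun h =>
    l₂' (hinj (le_antisymm h.1 h.2)).ge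
  have hcon := hstep.constraints hU hH
  have nconst : ¬ ((g x₁ ≤ g y₁ ↔ g x₂ ≤ g y₂) ∧ (g y₁ ≤ g x₁ ↔ g y₂ ≤ g x₂)) := by
    rintro ⟨h1, h2⟩
    rw [← h1, ← h2] at hstep
    exact hrot fun f _ => hstep.mem_of_const hU hH hG hAut f
  have nrot : ¬ (¬ g x₁ ≤ g y₁ ∧ ¬ g y₁ ≤ g x₁ ∧ ¬ g x₂ ≤ g y₂ ∧ g y₂ ≤ g x₂) := by
    rintro ⟨h1, h2, h3, h4⟩
    simp only [h1, h2, h3, h4] at hstep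
    exact hrot fun f hf => hstep.rotation_mem hH hG hAut f hf
  by_cases hle : x ≤ y
  · obtain ⟨t1, t2⟩ := hcan.le_iff hH hx₁ hy₁ (by grind) (by grind)
    grind
  · obtain ⟨t1, t2⟩ := hcan.le_iff hH hx₂ hy₂ (by grind) (by grind)
    grind

/-- A canonical function M-generated by `𝒢` which behaves like `id` on all orbits
behaves like `id` between all infinite orbits, or `𝒢` contains all rotations. -/
theorem canonical_id_between_infinite_orbits [Countable P] [Infinite P]
    (hU : IsUniversal P) (hH : IsHomogeneous P)
    (G : Subgroup (Equiv.Perm P)) (hG : IsClosedSubgroup G)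
    (hAut : ∀ f : Equiv.Perm P, IsOrderAuto f → f ∈ G)
    (n : ℕ) (c : Fin n → P) (g : P → P)
    (hcan : Canonical n c g) (hM : MGen G g)
    (hid : ∀ X : Set P, IsOrbit n c X → BehavesLikeId g X) :
    (∀ X Y : Set P, IsOrbit n c X → IsOrbit n c Y → X.Infinite → Y.Infinite →
      X ≠ Y → BehavesLikeIdBetween g X Y) ∨
    (∀ f : Equiv.Perm P, IsRotation f → f ∈ G) := by
  by_cases hrot : ∀ f : Equiv.Perm P, IsRotation f → f ∈ G
  · exact Or.inr hrot
  left
  have key := @le_iff_of_not_rotation P _ hU hH G hG hAut n c g hcan hM hid hrot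
  have hconst : ∀ X : Set P, IsOrbit n c X → X.Infinite → ∀ x ∈ X, ∀ k, x ≠ c k := by
    rintro X ⟨w, rfl⟩ hinf x ⟨h, hh, hw⟩ k hk
    have hwk : w = c k := h.injective (by rw [hw, hh.2 k, hk])
    apply hinf
    apply (Set.finite_singleton (c k)).subset
    rintro y ⟨h', hh', rfl⟩
    rw [hwk, hh'.2 k]
    rfl
  have hlt : ∀ x y : P, (∀ k, x ≠ c k) → (∀ k, y ≠ c k) → x < y → g x < g y := by
    intro x y hx hy hxy
    obtain ⟨z, hz⟩ := exists_point hU hH (S := insert x (insert y (Set.range c))) (Set.toFinite _)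
      (fun s => s ≤ x) (fun s => y ≤ s) (fun s _ t _ hst ht => hst.trans ht)
      (fun s _ t _ hst hs => hs.trans hst)
      (fun s _ t _ hs ht => (hs.trans_lt hxy).trans_le ht)
    have zx := hz x (by simp)
    have zy := hz y (by simp)
    have zc := fun k => hz (c k) (by simp)
    have hzc : ∀ k, z ≠ c k := by
      intro k hk
      have := zc k
      grind
    obtain ⟨a1, a2⟩ := key hx hzc (by intro k; have := zc k; have := hx k; grind) (by grind)
    obtain ⟨b1, b2⟩ := key hzc hy (by intro k; have := zc k; have := hy k; grind) (by grind)
    exact (lt_of_le_not_ge (a1.2 (by grind)) a2).trans (lt_of_le_not_ge (b1.2 (by grind)) b2)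
  have hperp : ∀ x y : P, (∀ k, x ≠ c k) → (∀ k, y ≠ c k) → Perp x y → ¬ g x ≤ g y := by
    intro x y hx hy ⟨p1, p2⟩ hle
    obtain ⟨z, hz⟩ := exists_point hU hH (S := insert x (insert y (Set.range c))) (Set.toFinite _)
      (fun s => s < x ∧ s < y) (fun s => x ≤ s ∨ y < s)
      (fun s _ t _ hst ht => ⟨hst.trans_lt ht.1, hst.trans_lt ht.2⟩)
      (fun s _ t _ hst hs => hs.imp (fun h => h.trans hst) (fun h => h.trans_le hst))
      (fun s _ t _ hs ht => ht.elim (fun h => hs.1.trans_le h) (fun h => hs.2.trans h))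
    have zx := hz x (by simp)
    have zy := hz y (by simp)
    have zc := fun k => hz (c k) (by simp)
    have hzc : ∀ k, z ≠ c k := by
      intro k hk
      have := zc k
      grind
    obtain ⟨a1, a2⟩ := key hzc hx (by intro k; have := zc k; have := (hx k).le_iff_lt; have := (hy k).le_iff_lt; grind)
      (by grind)
    obtain ⟨b1, b2⟩ := key hzc hy (by intro k; have := zc k; have := (hx k).le_iff_lt; have := (hy k).le_iff_lt; grind)
      (by grind)
    have := b1.1 ((a1.2 (by grind)).trans hle)
    grind
  intro X Y hX hY hXi hYi _ x hx y hy
  have hx' := hconst X hX hXi x hx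
  have hy' := hconst Y hY hYi y hy
  exact ⟨hlt x y hx' hy', hlt y x hy' hx', fun h =>
    ⟨hperp x y hx' hy' h, hperp y x hy' hx' ⟨h.2, h.1⟩⟩⟩
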